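/- Canonical path length bound for Twiggy Bayesian CART: Let 𝓔 be the Twiggy canonical path ensemble on 𝕋_L built from the Twiggy transition map. Then the length of the longest path satisfies ℓ(𝓔) = max_{𝒯,𝒯' ∈ 𝕋_L} |T_{𝒯,𝒯'}| ≤ 2^{L+1}. -/

import Mathlib

open Finset MeasureTheory Real
open scoped BigOperators NNReal ENNReal

noncomputable section

namespace BayesCART

/-! ## Trees

Nodes of the dyadic (Haar wavelet) tree are encoded by the index `j = 2^l + k`
(the root `ψ_{-1,0}` is `j = 0`, and `ψ_{l,k} ↦ 2^l + k` for `l ≥ 0`, `0 ≤ k < 2^l`).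
The children of a node `j ≥ 1` are `2j` and `2j+1`, the unique child of the root `0`
is `1`, and the parent of `j ≥ 1` is `j / 2`.  A tree is identified with the finite
set `S` of its internal nodes, which must contain the root and be ancestor-closed. -/

/-- `S` is the internal-node set of a tree all of whose internal nodes have depth `< L`. -/
def IsTree (L : ℕ) (S : Finset ℕ) : Prop :=
  0 ∈ S ∧ (∀ j ∈ S, 1 ≤ j → j / 2 ∈ S) ∧ ∀ j ∈ S, j < 2 ^ L

instance (L : ℕ) : DecidablePred (IsTree L) := fun _ => by unfold IsTree; infer_instance

/-- The (finite) collection `𝕋_L` of all trees with internal nodes of depth `< L`. -/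
def trees (L : ℕ) : Finset (Finset ℕ) :=
  (Finset.range (2 ^ L)).powerset.filter (IsTree L)

/-- The external (leaf) nodes `𝒯_ext` of the tree with internal nodes `S`. -/
def extSet (S : Finset ℕ) : Finset ℕ :=
  ((S.image fun j => 2 * j) ∪ S.image fun j => 2 * j + 1).filter fun j => j ∉ S

/-! ## The Haar design -/

/-- The Haar mother wavelet `ψ = 1_{(0,1/2]} − 1_{(1/2,1]}`. -/
def haarMother (x : ℝ) : ℝ :=
  if 0 < x ∧ x ≤ 1 / 2 then 1 else if 1 / 2 < x ∧ x ≤ 1 then -1 else 0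

/-- Entry `i` of column `j` of the Haar design matrix with `n` observations at the
design points `x_i = (i+1)/n`: column `j = 0` is `ψ_{-1,0} ≡ 1`, and column
`j = 2^l + k ≥ 1` is `ψ_{lk}(x) = 2^{l/2} ψ(2^l x − k)`. -/
def haarCol (n j i : ℕ) : ℝ :=
  if j = 0 then 1
  else
    (2 : ℝ) ^ ((Nat.log 2 j : ℝ) / 2) *
      haarMother ((2 : ℝ) ^ (Nat.log 2 j) * ((i + 1 : ℝ) / n) - ((j - 2 ^ Nat.log 2 j : ℕ) : ℝ))

/-- The inner product `X_j' Y` of the `j`-th design column with a vector `Y ∈ ℝⁿ`. -/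
def colDot (n : ℕ) (Y : Fin n → ℝ) (j : ℕ) : ℝ := ∑ i : Fin n, haarCol n j i.val * Y i

/-- The vector `X β* = Σ_{j ∈ B} β*_j ψ_j` of values of `f₀` at the design points. -/
def signalVec (n : ℕ) (β : ℕ → ℝ) (B : Finset ℕ) : Fin n → ℝ :=
  fun i => ∑ j ∈ B, β j * haarCol n j i.val

/-- The response `Y = X β* + ε`. -/
def Yvec (n : ℕ) (β : ℕ → ℝ) (B : Finset ℕ) (ε : Fin n → ℝ) : Fin n → ℝ :=
  fun i => signalVec n β B i + ε i

/-- The standard Gaussian measure of `ε = (ε_1, …, ε_n) ~ N(0, I_n)`. -/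
def gauss (n : ℕ) : Measure (Fin n → ℝ) :=
  Measure.pi fun _ => ProbabilityTheory.gaussianReal 0 1

/-! ## Prior and posterior -/

/-- The split probability `p_{lk} = n^{-c}`. -/
def splitP (n : ℕ) (c : ℝ) : ℝ := (n : ℝ) ^ (-c)

/-- Unnormalized Galton–Watson tree prior `Π(𝒯) ∝ ∏_{int} p ∏_{ext} (1 − p)`
with constant split probability `p`. -/
def priorWt (p : ℝ) (S : Finset ℕ) : ℝ := p ^ S.card * (1 - p) ^ (extSet S).card

/-- The marginal likelihood
`N_Y(𝒯) = (2π)^{-n/2} (1+n)^{-|𝒯_ext|/2} exp{−½ Y'[I − X_𝒯 Σ_𝒯 X_𝒯'] Y}`;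
for the orthogonal Haar design (`X'X = nI`) with `Σ_𝒯 = (n/(n+1))(X_𝒯'X_𝒯)^{-1}`,
`Y' X_𝒯 Σ_𝒯 X_𝒯' Y = (n+1)^{-1} Σ_{j ∈ 𝒯_int} (X_j'Y)²`. -/
def margLik (n : ℕ) (Y : Fin n → ℝ) (S : Finset ℕ) : ℝ :=
  (2 * π) ^ (-(n : ℝ) / 2) * ((1 + n : ℝ) ^ (-((extSet S).card : ℝ) / 2)) *
    Real.exp (-(1 / 2) * ((∑ i, Y i ^ 2) - (1 / ((n : ℝ) + 1)) * ∑ j ∈ S, colDot n Y j ^ 2))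

/-- Unnormalized posterior weight `Π(𝒯) N_Y(𝒯)`. -/
def postWt (n : ℕ) (p : ℝ) (Y : Fin n → ℝ) (S : Finset ℕ) : ℝ :=
  priorWt p S * margLik n Y S

/-- Posterior probability `Π(𝒯 ∣ Y)` of a single tree in `𝕋_L`. -/
def post (L n : ℕ) (p : ℝ) (Y : Fin n → ℝ) (S : Finset ℕ) : ℝ :=
  postWt n p Y S / ∑ T ∈ trees L, postWt n p Y T

/-- Posterior probability of a family of trees. -/
def postSet (L n : ℕ) (p : ℝ) (Y : Fin n → ℝ) (A : Finset (Finset ℕ)) : ℝ :=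
  ∑ T ∈ A ∩ trees L, post L n p Y T

/-! ## Assumption 1 -/

/-- Assumption 1: `f₀ = Σ_{(l,k) ∈ ℬ} β*_{lk} ψ_{lk}` with all signal
coefficients of magnitude in `(A log n / √n, C)`, and `𝒯* ∈ 𝕋_L` is the smallest
tree containing `ℬ` among its internal nodes. -/
structure Assumption1 (L n : ℕ) (A C : ℝ) (β : ℕ → ℝ) (B Sstar : Finset ℕ) : Prop where
  B_depth : ∀ j ∈ B, j < 2 ^ L
  signal_low : ∀ j ∈ B, A * Real.log n / Real.sqrt n < |β j|
  signal_high : ∀ j ∈ B, |β j| < C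
  support : ∀ j, j ∉ B → β j = 0
  Sstar_tree : Sstar ∈ trees L
  Sstar_contains : B ⊆ Sstar
  Sstar_min : ∀ T ∈ trees L, B ⊆ T → Sstar ⊆ T

/-! ## The Bayesian CART proposal -/

/-- GROW candidates: external nodes of depth `< L`. -/
def growCands (L : ℕ) (S : Finset ℕ) : Finset ℕ := (extSet S).filter fun j => j < 2 ^ L

/-- PRUNE candidates: pre-terminal internal nodes (no children internal), root excluded. -/
def pruneCands (S : Finset ℕ) : Finset ℕ :=
  S.filter fun j => j ≠ 0 ∧ 2 * j ∉ S ∧ 2 * j + 1 ∉ S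

/-- The GROW/PRUNE proposal kernel of (dyadic) Bayesian CART: GROW and PRUNE are
chosen with probability `1/2` each (with forced moves at the null and the full tree),
a GROW splits a uniformly chosen external node, and a PRUNE collapses a uniformly
chosen pre-terminal node. -/
def bcartProp (L : ℕ) (S S' : Finset ℕ) : ℝ :=
  (if (pruneCands S).Nonempty then (1 : ℝ) / 2 else 1) *
      (((growCands L S).filter fun j => insert j S = S').card / (growCands L S).card)
    + (if (growCands L S).Nonempty then (1 : ℝ) / 2 else 1) *
      (((pruneCands S).filter fun j => S.erase j = S').card / (pruneCands S).card)

/-! ## Metropolis–Hastings machinery -/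

/-- The Metropolis–Hastings transition matrix on `𝕋_L` with target `π₀` and proposal `q`. -/
def mhTrans (L : ℕ) (π₀ : Finset ℕ → ℝ) (q : Finset ℕ → Finset ℕ → ℝ)
    (S S' : Finset ℕ) : ℝ :=
  if S' = S then
    1 - ∑ T ∈ (trees L).erase S, q S T * min 1 ((π₀ T * q T S) / (π₀ S * q S T))
  else q S S' * min 1 ((π₀ S' * q S' S) / (π₀ S * q S S'))

/-- The lazy modification `(P + I)/2` of a transition matrix. -/
def lazy (P : Finset ℕ → Finset ℕ → ℝ) (S S' : Finset ℕ) : ℝ :=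
  (1 / 2) * P S S' + if S' = S then 1 / 2 else 0

/-- `t`-step transition probabilities over the state space `𝕋_L`. -/
def iterP (L : ℕ) (P : Finset ℕ → Finset ℕ → ℝ) : ℕ → Finset ℕ → Finset ℕ → ℝ
  | 0, S, S' => if S' = S then 1 else 0
  | t + 1, S, S' => ∑ T ∈ trees L, iterP L P t S T * P T S'

/-- Total variation distance `‖P^t(S, ·) − Π(· ∣ Y)‖_TV` between the chain at time `t`
started at `S` and the posterior. -/
def tvDist (L n : ℕ) (p : ℝ) (Y : Fin n → ℝ) (P : Finset ℕ → Finset ℕ → ℝ)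
    (t : ℕ) (S : Finset ℕ) : ℝ :=
  (1 / 2) * ∑ T ∈ trees L, |iterP L P t S T - post L n p Y T|

/-- The `ε`-mixing time `τ_ε = max_{𝒯 ∈ 𝕋_L} min{t : Δ_𝒯(t') ≤ ε for all t' ≥ t}`. -/
def mixTime (L n : ℕ) (p : ℝ) (Y : Fin n → ℝ) (P : Finset ℕ → Finset ℕ → ℝ) (ε : ℝ) : ℕ :=
  sInf {t | ∀ t' ≥ t, ∀ S ∈ trees L, tvDist L n p Y P t' S ≤ ε}

/-- The (non-lazy) Bayesian CART Metropolis–Hastings transition matrix. -/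
def bcartP (L n : ℕ) (c : ℝ) (Y : Fin n → ℝ) : Finset ℕ → Finset ℕ → ℝ :=
  mhTrans L (post L n (splitP n c) Y) (bcartProp L)

end BayesCART
namespace BayesCART

/-! ## Twigs and the Twiggy proposal -/

/-- `isAnc a b`: node `a` is a strict ancestor of node `b`. -/
def isAnc (a b : ℕ) : Prop := ∃ t ∈ Finset.Icc 1 b, b / 2 ^ t = a

instance (a b : ℕ) : Decidable (isAnc a b) := by unfold isAnc; infer_instance

/-- All nodes on the ancestral path from node `j` up to the root (including `j`). -/
def ancPath (j : ℕ) : Finset ℕ := (Finset.range (j + 1)).image fun t => j / 2 ^ t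

/-- The tree obtained from `S` by growing, from the closest external node,
the twig ending at the node `j`: the smallest tree containing `S ∪ {j}`. -/
def growTwig (S : Finset ℕ) (j : ℕ) : Finset ℕ := S ∪ ancPath j

/-- The internal descendants of `j` inside the tree `S`. -/
def descIn (S : Finset ℕ) (j : ℕ) : Finset ℕ := S.filter fun m => isAnc j m

/-- Twiggy PRUNE candidates: non-root internal nodes whose internal descendants
form a twig (a chain in the ancestry order). -/
def twigPruneCands (S : Finset ℕ) : Finset ℕ :=
  S.filter fun j => j ≠ 0 ∧
    ∀ a ∈ descIn S j, ∀ b ∈ descIn S j, a = b ∨ isAnc a b ∨ isAnc b a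

/-- The tree obtained by the Twiggy PRUNE at `j`: remove `j` and all of its descendants. -/
def pruneTwig (S : Finset ℕ) (j : ℕ) : Finset ℕ := S \ insert j (descIn S j)

/-- Nodes of layer (depth) `l` missing from `S`. -/
def layerNodes (S : Finset ℕ) (l : ℕ) : Finset ℕ :=
  (Finset.Ico (2 ^ l) (2 ^ (l + 1))).filter fun j => j ∉ S

/-- Probability `d_{l} = D^{-l} / Σ_{l' ∈ E} D^{-l'}` of picking layer `l` among the
eligible layers. -/
def layerWt (D : ℝ) (L : ℕ) (S : Finset ℕ) (l : ℕ) : ℝ :=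
  D ^ (-(l : ℝ)) /
    ∑ l' ∈ (Finset.range L).filter (fun l' => (layerNodes S l').Nonempty), D ^ (-(l' : ℝ))

/-- The Twiggy Bayesian CART proposal kernel: GROW picks a layer with probability
`∝ D^{-l}` then a missing node uniformly within the layer and attaches the whole twig
to it; PRUNE removes a uniformly chosen twig. -/
def twiggyProp (L : ℕ) (D : ℝ) (S S' : Finset ℕ) : ℝ :=
  (if (twigPruneCands S).Nonempty then (1 : ℝ) / 2 else 1) *
      ∑ l ∈ Finset.range L, layerWt D L S l *
        (((layerNodes S l).filter fun j => growTwig S j = S').card / (layerNodes S l).card)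
    + (if ∃ l ∈ Finset.range L, (layerNodes S l).Nonempty then (1 : ℝ) / 2 else 1) *
      (((twigPruneCands S).filter fun j => pruneTwig S j = S').card / (twigPruneCands S).card)

/-- The (non-lazy) Twiggy Bayesian CART Metropolis–Hastings transition matrix. -/
def twiggyP (L n : ℕ) (c D : ℝ) (Y : Fin n → ℝ) : Finset ℕ → Finset ℕ → ℝ :=
  mhTrans L (post L n (splitP n c) Y) (twiggyProp L D)

/-! ## Locally informed (LIT-MH) proposals -/

/-- GROW neighborhood `𝒩_g(𝒯)` of Bayesian CART: one extra internal node. -/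
def bNg (L : ℕ) (S : Finset ℕ) : Finset (Finset ℕ) :=
  (growCands L S).image fun j => insert j S

/-- PRUNE neighborhood `𝒩_p(𝒯)` of Bayesian CART: one internal node removed. -/
def bNp (S : Finset ℕ) : Finset (Finset ℕ) := (pruneCands S).image fun j => S.erase j

/-- GROW neighborhood of Twiggy Bayesian CART: one extra twig. -/
def tNg (L : ℕ) (S : Finset ℕ) : Finset (Finset ℕ) :=
  (((Finset.range (2 ^ L)).filter fun j => j ∉ S)).image fun j => growTwig S j

/-- PRUNE neighborhood of Twiggy Bayesian CART: one twig removed. -/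
def tNp (S : Finset ℕ) : Finset (Finset ℕ) := (twigPruneCands S).image fun j => pruneTwig S j

/-- The posterior ratio `B(𝒯, 𝒯̃) = Π(𝒯̃|Y)/Π(𝒯|Y)`. -/
def postRatio (L n : ℕ) (c : ℝ) (Y : Fin n → ℝ) (S S' : Finset ℕ) : ℝ :=
  post L n (splitP n c) Y S' / post L n (splitP n c) Y S

/-- Informed GROW weight `w_g(𝒯̃|𝒯) = min{Π(𝒯̃|Y)/Π(𝒯|Y), n^{(A² log n)/8}}`. -/
def wg (L n : ℕ) (c A : ℝ) (Y : Fin n → ℝ) (S S' : Finset ℕ) : ℝ :=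
  min (postRatio L n c Y S S') ((n : ℝ) ^ ((A ^ 2 * Real.log n) / 8))

/-- Informed PRUNE weight `w_p(𝒯̃|𝒯) = max{1, min{Π(𝒯̃|Y)/Π(𝒯|Y), n^{c−3/2}}}`. -/
def wp (L n : ℕ) (c : ℝ) (Y : Fin n → ℝ) (S S' : Finset ℕ) : ℝ :=
  max 1 (min (postRatio L n c Y S S') ((n : ℝ) ^ (c - 3 / 2)))

/-- Normalizing constant `Z_g(𝒯)` of the informed GROW proposal. -/
def Zg (L n : ℕ) (c A : ℝ) (Y : Fin n → ℝ) (Ng : Finset ℕ → Finset (Finset ℕ))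
    (S : Finset ℕ) : ℝ := ∑ T ∈ Ng S, wg L n c A Y S T

/-- Normalizing constant `Z_p(𝒯)` of the informed PRUNE proposal. -/
def Zp (L n : ℕ) (c : ℝ) (Y : Fin n → ℝ) (Np : Finset ℕ → Finset (Finset ℕ))
    (S : Finset ℕ) : ℝ := ∑ T ∈ Np S, wp L n c Y S T

/-- The locally informed (LIT-MH) proposal with neighborhoods `Ng`, `Np`. -/
def infProp (L n : ℕ) (c A : ℝ) (Y : Fin n → ℝ)
    (Ng Np : Finset ℕ → Finset (Finset ℕ)) (S S' : Finset ℕ) : ℝ :=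
  (1 / 2) * (if S' ∈ Ng S then wg L n c A Y S S' / Zg L n c A Y Ng S else 0)
    + (1 / 2) * (if S' ∈ Np S then wp L n c Y S S' / Zp L n c Y Np S else 0)

/-- The informed Bayesian CART Metropolis–Hastings transition matrix. -/
def infBcartP (L n : ℕ) (c A : ℝ) (Y : Fin n → ℝ) : Finset ℕ → Finset ℕ → ℝ :=
  mhTrans L (post L n (splitP n c) Y) (infProp L n c A Y (bNg L) bNp)

/-- The informed Twiggy Bayesian CART Metropolis–Hastings transition matrix. -/
def infTwiggyP (L n : ℕ) (c A : ℝ) (Y : Fin n → ℝ) : Finset ℕ → Finset ℕ → ℝ :=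
  mhTrans L (post L n (splitP n c) Y) (infProp L n c A Y (tNg L) tNp)

/-! ## Drift functions -/

/-- The first drift function
`V₁(𝒯) = exp{(2^L (C+2)² (n+1))^{-1} · Y'(I − P_𝒯/n)Y}`, where
`Y' P_𝒯 Y = Σ_{j ∈ 𝒯_int} (X_j'Y)²` for the orthogonal Haar design. -/
def V1 (L n : ℕ) (C : ℝ) (Y : Fin n → ℝ) (S : Finset ℕ) : ℝ :=
  Real.exp ((1 / (2 ^ L * (C + 2) ^ 2 * ((n : ℝ) + 1))) *
    ((∑ i, Y i ^ 2) - (1 / (n : ℝ)) * ∑ j ∈ S, colDot n Y j ^ 2))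

/-- The second drift function
`V₂(𝒯) = exp{2^{-L}(|𝒯_int ∖ 𝒯*_int| + min(|𝒯*_int ∖ 𝒯_int|,1)·(2^L − |𝒯_int ∪ 𝒯*_int|))}`. -/
def V2 (L : ℕ) (Sstar S : Finset ℕ) : ℝ :=
  Real.exp ((1 / 2 ^ L) * (((S \ Sstar).card : ℝ) +
    min (((Sstar \ S).card : ℝ)) 1 * ((2 ^ L : ℝ) - ((S ∪ Sstar).card : ℝ))))

/-- Drift ratio `R(𝒯, 𝒯̃) = V(𝒯̃)/V(𝒯) − 1`. -/
def driftR (V : Finset ℕ → ℝ) (S S' : Finset ℕ) : ℝ := V S' / V S - 1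

/-- `(PV)(𝒯) = Σ_{𝒯̃ ∈ 𝕋_L} V(𝒯̃) P(𝒯, 𝒯̃)`. -/
def PV (L : ℕ) (P : Finset ℕ → Finset ℕ → ℝ) (V : Finset ℕ → ℝ) (S : Finset ℕ) : ℝ :=
  ∑ T ∈ trees L, V T * P S T

/-! ## Canonical paths -/

/-- The Bayesian CART canonical transition map `𝒢` toward `𝒯*`: if the tree has
redundant internal nodes, remove the deepest rightmost one (maximal `j = 2^l + k`);
otherwise (when `𝒯 ⊂ 𝒯*`) add the deepest rightmost external node lying in `𝒯*_int`. -/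
def gMap (Sstar S : Finset ℕ) : Finset ℕ :=
  if S = Sstar then S
  else
    match (S \ Sstar).max with
    | some j => S.erase j
    | none =>
      match ((extSet S) ∩ Sstar).max with
      | some j => insert j S
      | none => S

/-- The Twiggy canonical transition map toward `𝒯*`: if the tree has redundant
internal nodes, remove the shallowest leftmost one whose internal descendants form a
twig, together with its whole twig of descendants; otherwise grow the twig toward the
deepest rightmost node of `𝒯*_int` missing from `𝒯`. -/
def gTwig (Sstar S : Finset ℕ) : Finset ℕ :=
  if S = Sstar then S
  else
    match ((S \ Sstar).filter fun j =>
        ∀ a ∈ descIn S j, ∀ b ∈ descIn S j, a = b ∨ isAnc a b ∨ isAnc b a).min with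
    | some j => pruneTwig S j
    | none =>
      match (Sstar \ S).max with
      | some j => growTwig S j
      | none => S

/-- The set of states on the canonical path from `S` to `𝒯*` (iterating the
transition map `g`; `g` fixes `𝒯*`, and the fuel `2^(2L+2)` is ample). -/
def pathStates (L : ℕ) (g : Finset ℕ → Finset ℕ) (S : Finset ℕ) : Finset (Finset ℕ) :=
  (Finset.range (2 ^ (2 * L + 2) + 1)).image fun t => g^[t] S

/-- The length `|T_{𝒯,𝒯'}|` of the collapsed canonical path between `𝒯` and `𝒯'`:
the number of states of either path to `𝒯*` that are not on the other path. -/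
def pathLen (L : ℕ) (g : Finset ℕ → Finset ℕ) (S S' : Finset ℕ) : ℕ :=
  (pathStates L g S \ pathStates L g S').card + (pathStates L g S' \ pathStates L g S).card

/-- The directed edges traversed by the canonical path from `S` to `𝒯*`. -/
def pathEdges (L : ℕ) (g : Finset ℕ → Finset ℕ) (S : Finset ℕ) :
    Finset (Finset ℕ × Finset ℕ) :=
  ((Finset.range (2 ^ (2 * L + 2))).image fun t => (g^[t] S, g^[t + 1] S)).filter
    fun e => e.1 ≠ e.2

/-- The edge `e` lies on the collapsed canonical path `T_{𝒯,𝒯'}` (in the forward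
direction along `T_{𝒯,𝒯*}`, or backward along `T_{𝒯',𝒯*}`), the common portion of
the two paths being removed. -/
def onPath (L : ℕ) (g : Finset ℕ → Finset ℕ) (e : Finset ℕ × Finset ℕ)
    (S S' : Finset ℕ) : Prop :=
  (e ∈ pathEdges L g S ∧ e ∉ pathEdges L g S') ∨
    (e.swap ∈ pathEdges L g S' ∧ e.swap ∉ pathEdges L g S)

instance (L : ℕ) (g : Finset ℕ → Finset ℕ) (e : Finset ℕ × Finset ℕ) (S S' : Finset ℕ) :
    Decidable (onPath L g e S S') := by unfold onPath; infer_instance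

end BayesCART

namespace BayesCART

/-- A map that either fixes a state or strictly decreases a potential `d` visits at most
`d S + 1` states along an orbit. -/
lemma card_image_iterate_le {α : Type*} [DecidableEq α] (g : α → α) (d : α → ℕ)
    (hg : ∀ S, g S = S ∨ d (g S) < d S) (N : ℕ) (S : α) :
    ((Finset.range N).image fun t => g^[t] S).card ≤ d S + 1 := by
  induction N generalizing S with
  | zero => simp
  | succ N ih =>
    rcases hg S with h | h
    · refine (Finset.card_le_card (t := {S}) ?_).trans (by simp)
      intro T hT
      obtain ⟨t, -, rfl⟩ := Finset.mem_image.1 hT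
      simpa using Function.iterate_fixed h t
    · have hsub : ((Finset.range (N + 1)).image fun t => g^[t] S) ⊆
          insert S ((Finset.range N).image fun t => g^[t] (g S)) := by
        intro T hT
        obtain ⟨t, ht, rfl⟩ := Finset.mem_image.1 hT
        cases t with
        | zero => simp
        | succ t =>
          refine Finset.mem_insert_of_mem (Finset.mem_image.2 ⟨t, ?_, rfl⟩)
          simpa using ht
      have h₁ := Finset.card_le_card hsub
      have h₂ := Finset.card_insert_le S ((Finset.range N).image fun t => g^[t] (g S))
      have h₃ := ih (g S)
      omega

lemma IsTree.div_two_pow_mem {L : ℕ} {S : Finset ℕ} (hS : IsTree L S) {j : ℕ} (hj : j ∈ S)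
    (t : ℕ) : j / 2 ^ t ∈ S := by
  induction t with
  | zero => simpa using hj
  | succ t ih =>
    rw [pow_succ, ← Nat.div_div_eq_div_mul]
    rcases Nat.eq_zero_or_pos (j / 2 ^ t) with h | h
    · rw [h]; exact hS.1
    · exact hS.2.1 _ ih h

lemma symmDiff_pruneTwig_ssubset {L : ℕ} {Sstar S : Finset ℕ} (hstar : IsTree L Sstar) {j : ℕ}
    (hj : j ∈ S \ Sstar) : symmDiff (pruneTwig S j) Sstar ⊂ symmDiff S Sstar := by
  obtain ⟨hjS, hjstar⟩ := Finset.mem_sdiff.1 hj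
  have hdesc : ∀ m ∈ Sstar, m ∉ insert j (descIn S j) := by
    intro m hm hmem
    rcases Finset.mem_insert.1 hmem with rfl | h
    · exact hjstar hm
    · obtain ⟨t, -, rfl⟩ := (Finset.mem_filter.1 h).2
      exact hjstar (hstar.div_two_pow_mem hm t)
  refine Finset.ssubset_iff_of_subset ?_ |>.2 ⟨j, ?_, ?_⟩
  · intro m hm
    have := hdesc m
    simp only [pruneTwig, Finset.mem_symmDiff, Finset.mem_sdiff] at hm ⊢
    tauto
  · simp [Finset.mem_symmDiff, hjS, hjstar]
  · simp [Finset.mem_symmDiff, pruneTwig, hjstar]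

lemma symmDiff_growTwig_ssubset {L : ℕ} {Sstar S : Finset ℕ} (hstar : IsTree L Sstar) {j : ℕ}
    (hj : j ∈ Sstar \ S) : symmDiff (growTwig S j) Sstar ⊂ symmDiff S Sstar := by
  obtain ⟨hjstar, hjS⟩ := Finset.mem_sdiff.1 hj
  have hanc : ∀ m ∈ ancPath j, m ∈ Sstar := by
    intro m hm
    obtain ⟨t, -, rfl⟩ := Finset.mem_image.1 hm
    exact hstar.div_two_pow_mem hjstar t
  have hself : j ∈ ancPath j := Finset.mem_image.2 ⟨0, by simp, by simp⟩
  refine Finset.ssubset_iff_of_subset ?_ |>.2 ⟨j, ?_, ?_⟩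
  · intro m hm
    have := hanc m
    simp only [growTwig, Finset.mem_symmDiff, Finset.mem_union] at hm ⊢
    tauto
  · simp [Finset.mem_symmDiff, hjS, hjstar]
  · simp [Finset.mem_symmDiff, growTwig, hjstar, hself]

lemma gTwig_eq_or_card_symmDiff_lt {L : ℕ} {Sstar : Finset ℕ} (hstar : IsTree L Sstar)
    (S : Finset ℕ) :
    gTwig Sstar S = S ∨ (symmDiff (gTwig Sstar S) Sstar).card < (symmDiff S Sstar).card := by
  unfold gTwig
  split_ifs with h
  · exact Or.inl rfl
  split
  next j hj =>
    exact Or.inr <| Finset.card_lt_card <| symmDiff_pruneTwig_ssubset hstar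
      (Finset.mem_filter.1 (Finset.mem_of_min hj)).1
  next =>
    split
    next j hj =>
      exact Or.inr <| Finset.card_lt_card <| symmDiff_growTwig_ssubset hstar
        (Finset.mem_of_max hj)
    next => exact Or.inl rfl

lemma card_symmDiff_lt_two_pow {L : ℕ} {S T : Finset ℕ} (hS : IsTree L S) (hT : IsTree L T) :
    (symmDiff S T).card < 2 ^ L := by
  have hsub : symmDiff S T ⊂ Finset.range (2 ^ L) := by
    refine Finset.ssubset_iff_of_subset ?_ |>.2 ⟨0, by simp, ?_⟩
    · intro m hm
      rcases Finset.mem_symmDiff.1 hm with h | h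
      · exact Finset.mem_range.2 (hS.2.2 m h.1)
      · exact Finset.mem_range.2 (hT.2.2 m h.1)
    · simp [Finset.mem_symmDiff, hS.1, hT.1]
  simpa using Finset.card_lt_card hsub

lemma card_pathStates_gTwig_le {L : ℕ} {Sstar S : Finset ℕ} (hstar : IsTree L Sstar)
    (hS : IsTree L S) : (pathStates L (gTwig Sstar) S).card ≤ 2 ^ L :=
  (card_image_iterate_le (gTwig Sstar) (fun T => (symmDiff T Sstar).card)
    (gTwig_eq_or_card_symmDiff_lt hstar) _ S).trans (card_symmDiff_lt_two_pow hS hstar)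

/-- **Lemma (Canonical path length for Twiggy Bayesian CART).**
Let `𝓔` be the Twiggy canonical path ensemble on `𝕋_L` built from the Twiggy
transition map toward a target tree `𝒯* ∈ 𝕋_L`.  Then the length of the canonical
path between any two trees `𝒯, 𝒯' ∈ 𝕋_L` is at most `2^{L+1}`; in particular
`ℓ(𝓔) = max_{𝒯,𝒯'∈𝕋_L} |T_{𝒯,𝒯'}| ≤ 2^{L+1}`. -/
theorem twiggy_canonical_path_length
    (L : ℕ) (Sstar : Finset ℕ) (hstar : Sstar ∈ trees L)
    (S S' : Finset ℕ) (hS : S ∈ trees L) (hS' : S' ∈ trees L) :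
    pathLen L (gTwig Sstar) S S' ≤ 2 ^ (L + 1) := by
  have hstar' := (Finset.mem_filter.1 hstar).2
  have h₁ := card_pathStates_gTwig_le hstar' (Finset.mem_filter.1 hS).2
  have h₂ := card_pathStates_gTwig_le hstar' (Finset.mem_filter.1 hS').2
  have h₃ := Finset.card_le_card (Finset.sdiff_subset
    (s := pathStates L (gTwig Sstar) S) (t := pathStates L (gTwig Sstar) S'))
  have h₄ := Finset.card_le_card (Finset.sdiff_subset
    (s := pathStates L (gTwig Sstar) S') (t := pathStates L (gTwig Sstar) S))
  rw [pathLen, pow_succ]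
  omega

end BayesCART
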